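/- Let G = (V,E) be a finite simple graph with all edge weights equal to a single variable w and let G' be obtained from G by adding an apex vertex a joined to every v ∈ V by an edge of weight −1. Then the multivariate forest polynomial of G' satisfies F(G') = Σ_{A ∈ 𝔽(G)} w^{|A|} · ∏_{T ∈ c(A)} (1 − |T|). -/

import Mathlib

open scoped Classical

/-- An edge subset is acyclic (a forest) if the spanning subgraph `(V, A)` has no cycle. -/
def IsForestEdgeSet {V : Type*} (A : Finset (Sym2 V)) : Prop :=
  (SimpleGraph.fromEdgeSet (A : Set (Sym2 V))).IsAcyclic

/-- The collection `c(A)` of vertex sets of the connected components of a graph `H` on a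
finite vertex set (including singleton components). -/
noncomputable def componentSets {V : Type*} [Fintype V] (H : SimpleGraph V) :
    Finset (Finset V) :=
  Finset.univ.image (fun v => Finset.univ.filter (fun u => H.Reachable v u))

/-- The apex graph `G'` of `G`: a new vertex `a = none` is joined to every vertex of `G`. -/
def apexGraph {V : Type*} (G : SimpleGraph V) : SimpleGraph (Option V) :=
  SimpleGraph.fromRel (fun x y =>
    match x, y with
    | some u, some v => G.Adj u v
    | none, some _ => True
    | _, _ => False)

namespace SimpleGraph

variable {V : Type*}

/-- The graph on `Option V` obtained from `H` by joining the new vertex `none` to the vertices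
in `S`. -/
def coneOver (H : SimpleGraph V) (S : Set V) : SimpleGraph (Option V) where
  Adj
    | none, some v => v ∈ S
    | some v, none => v ∈ S
    | some u, some v => H.Adj u v
    | none, none => False
  symm := ⟨by rintro (_ | u) (_ | v) h <;> first | exact h | exact h.symm⟩
  loopless := ⟨by rintro (_ | u) h <;> first | exact h | exact H.irrefl h⟩

variable {H : SimpleGraph V} {S : Set V} {u v : V}

@[simp]
lemma coneOver_adj_some_some : (H.coneOver S).Adj (some u) (some v) ↔ H.Adj u v := Iff.rfl

@[simp]
lemma coneOver_adj_none_some : (H.coneOver S).Adj none (some v) ↔ v ∈ S := Iff.rfl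

@[simp]
lemma coneOver_adj_some_none : (H.coneOver S).Adj (some v) none ↔ v ∈ S := Iff.rfl

lemma coneOver_insert : H.coneOver (insert v S) = H.coneOver S ⊔ edge none (some v) := by
  ext (_ | x) (_ | y) <;> simp [edge_adj, or_comm]

lemma reachable_coneOver_none_some :
    (H.coneOver S).Reachable none (some v) ↔ ∃ s ∈ S, H.Reachable s v := by
  refine ⟨fun h => ?_, fun ⟨s, hs, h⟩ => ?_⟩
  · let P : Option V → Prop := fun x => ∀ v ∈ x, ∃ s ∈ S, H.Reachable s v
    have key : ∀ x, (H.coneOver S).Reachable none x → P x := by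
      intro x hx
      rw [reachable_iff_reflTransGen] at hx
      induction hx with
      | refl => simp [P]
      | @tail b c _ hbc ih =>
        rcases b with _ | b <;> rcases c with _ | c <;> simp only [P] at ih ⊢
        · simp
        · rintro _ ⟨⟩
          exact ⟨c, hbc, .rfl⟩
        · simp
        · rintro _ ⟨⟩
          obtain ⟨s, hs, h⟩ := ih b rfl
          exact ⟨s, hs, h.trans (Adj.reachable hbc)⟩
    exact key _ h v rfl
  · exact (Adj.reachable (coneOver_adj_none_some.mpr hs)).trans
      (h.map (⟨some, fun h => h⟩ : H →g H.coneOver S))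

lemma isAcyclic_coneOver_empty : (H.coneOver ∅).IsAcyclic ↔ H.IsAcyclic := by
  refine ⟨fun h => h.comap ⟨some, fun h => h⟩ (Option.some_injective V), fun h => ?_⟩
  rw [isAcyclic_iff_forall_adj_isBridge] at h ⊢
  rintro (_ | u) (_ | v) huv
  · exact huv.elim
  · exact huv.elim
  · exact huv.elim
  · specialize h huv
    rw [isBridge_iff] at h ⊢
    refine fun hr => h (hr.map (⟨fun x => x.getD u, ?_⟩ :
      (H.coneOver ∅).deleteEdges {s(some u, some v)} →g H.deleteEdges {s(u, v)}))
    rintro (_ | a) (_ | b) hab <;> simp_all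

lemma isAcyclic_coneOver_iff {S : Finset V} :
    (H.coneOver (S : Set V)).IsAcyclic ↔
      H.IsAcyclic ∧ Set.InjOn H.connectedComponentMk (S : Set V) := by
  induction S using Finset.induction_on with
  | empty => simp [isAcyclic_coneOver_empty]
  | insert v S hv ih =>
    rw [Finset.coe_insert, coneOver_insert, isAcyclic_sup_fromEdgeSet_iff, ih,
      Set.injOn_insert (by simpa using hv), reachable_coneOver_none_some]
    simp [hv, and_assoc]

end SimpleGraph

lemma Finset.sum_neg_one_pow_card_injOn {V Q R : Type*} [Fintype V] [Fintype Q] [CommRing R]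
    (f : V → Q) :
    ∑ S ∈ (Finset.univ : Finset (Finset V)).filter (fun S : Finset V => Set.InjOn f (S : Set V)),
        (-1 : R) ^ S.card =
      ∏ q, (1 - ((Finset.univ.filter (fun v => f v = q)).card : R)) := by
  have hfactor (T : Finset V) :
      ∑ B ∈ T.powerset with B.card ≤ 1, (-1 : R) ^ B.card = 1 - (T.card : R) := by
    have hT : T.powerset.filter (fun B => B.card ≤ 1) =
        insert ∅ (T.map ⟨singleton, Finset.singleton_injective⟩) := by
      ext B
      simp only [Finset.mem_filter, Finset.mem_powerset, Finset.mem_insert, Finset.mem_map,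
        Function.Embedding.coeFn_mk, Nat.le_one_iff_eq_zero_or_eq_one, Finset.card_eq_zero,
        Finset.card_eq_one]
      constructor
      · rintro ⟨hB, rfl | ⟨a, rfl⟩⟩
        · exact .inl rfl
        · exact .inr ⟨a, by simpa using hB, rfl⟩
      · rintro (rfl | ⟨a, ha, rfl⟩)
        · simp
        · simpa using ha
    rw [hT, Finset.sum_insert (by simp)]
    simp [sub_eq_add_neg]
  simp_rw [← hfactor]
  rw [Finset.prod_univ_sum]
  refine Finset.sum_bij' (fun S _ q => S.filter (fun v => f v = q))
    (fun p _ => Finset.univ.filter fun v => v ∈ p (f v)) ?_ ?_ ?_ ?_ ?_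
  · intro S hS
    simp only [Finset.mem_filter, Finset.mem_univ, true_and] at hS
    simp only [Fintype.mem_piFinset, Finset.mem_filter, Finset.mem_powerset, Finset.card_le_one]
    refine fun q => ⟨Finset.filter_subset_filter _ (Finset.subset_univ S), ?_⟩
    rintro a ⟨ha, rfl⟩ b ⟨hb, hab⟩
    exact hS ha hb hab.symm
  · intro p hp
    simp only [Fintype.mem_piFinset, Finset.mem_filter, Finset.mem_powerset, Finset.card_le_one]
      at hp
    simp only [Finset.mem_filter, Finset.mem_univ, true_and]
    intro a ha b hb hab
    simp only [Finset.coe_filter, Finset.mem_univ, true_and, Set.mem_ofPred_eq] at ha hb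
    exact (hp (f a)).2 a ha b (hab ▸ hb)
  · intro S hS
    ext v
    simp
  · intro p hp
    simp only [Fintype.mem_piFinset, Finset.mem_filter, Finset.mem_powerset] at hp
    ext q v
    simp only [Finset.mem_filter, Finset.mem_univ, true_and]
    refine ⟨fun ⟨h, e⟩ => e ▸ h, fun h => ?_⟩
    have := (hp q).1 h
    simp only [Finset.mem_filter, Finset.mem_univ, true_and] at this
    exact ⟨this.symm ▸ h, this⟩
  · intro S hS
    rw [Finset.prod_pow_eq_pow_sum]
    congr 1
    exact Finset.card_eq_sum_card_fiberwise (by simp [Set.MapsTo])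

lemma prod_componentSets {V R : Type*} [Fintype V] [CommMonoid R] (H : SimpleGraph V)
    (g : Finset V → R) :
    ∏ T ∈ componentSets H, g T =
      ∏ c : H.ConnectedComponent, g (Finset.univ.filter fun v => H.connectedComponentMk v = c) := by
  have himage : componentSets H = Finset.univ.image
      (fun c => Finset.univ.filter fun v => H.connectedComponentMk v = c) := by
    ext T
    simp only [componentSets, Finset.mem_image, Finset.mem_univ, true_and,
      SimpleGraph.ConnectedComponent.exists, SimpleGraph.ConnectedComponent.eq,
      SimpleGraph.reachable_comm]
  rw [himage, Finset.prod_image]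
  intro c _ d _ h
  induction c using SimpleGraph.ConnectedComponent.ind with | _ v
  have hv := Finset.ext_iff.mp h v
  simpa using hv

/-- The embedding sending `v` to the edge joining the apex `none` to `some v`. -/
def apexEdge (V : Type*) : V ↪ Sym2 (Option V) where
  toFun v := s(none, some v)
  inj' u v h := by simpa using h

@[simp]
lemma apexEdge_apply {V : Type*} (v : V) : apexEdge V v = s(none, some v) := rfl

/-- The edge set of the cone over `(V, A)` whose apex `none` is joined to the vertices in `S`. -/
noncomputable def coneEdges {V : Type*} (A : Finset (Sym2 V)) (S : Finset V) :
    Finset (Sym2 (Option V)) :=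
  A.map (Function.Embedding.some.sym2Map) ∪
    S.map (apexEdge V)

section coneEdges

variable {V : Type*} {A : Finset (Sym2 V)} {S : Finset V}

@[simp]
lemma some_some_mem_coneEdges {u v : V} : s(some u, some v) ∈ coneEdges A S ↔ s(u, v) ∈ A := by
  have h : s(some u, some v) = Function.Embedding.some.sym2Map s(u, v) := rfl
  simp only [coneEdges, Finset.mem_union, h, Finset.mem_map']
  simp

@[simp]
lemma none_some_mem_coneEdges {v : V} : s(none, some v) ∈ coneEdges A S ↔ v ∈ S := by
  simp [coneEdges, Sym2.exists]

@[simp]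
lemma none_none_notMem_coneEdges : s(none, none) ∉ coneEdges A S := by
  simp [coneEdges, Sym2.exists]

lemma fromEdgeSet_coneEdges :
    SimpleGraph.fromEdgeSet (coneEdges A S : Set (Sym2 (Option V))) =
      (SimpleGraph.fromEdgeSet (A : Set (Sym2 V))).coneOver S := by
  ext (_ | u) (_ | v) <;> simp [Sym2.eq_swap (a := some _) (b := none)]

lemma prod_coneEdges {R : Type*} [CommMonoid R] (W : Sym2 (Option V) → R) :
    ∏ e ∈ coneEdges A S, W e =
      (∏ e ∈ A, W (e.map some)) * ∏ v ∈ S, W s(none, some v) := by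
  rw [coneEdges, Finset.prod_union, Finset.prod_map, Finset.prod_map]
  · rfl
  · simp only [Finset.disjoint_left, Finset.mem_map]
    rintro _ ⟨e, -, rfl⟩ ⟨v, -, h⟩
    induction e using Sym2.ind
    simp at h

lemma isForestEdgeSet_coneEdges :
    IsForestEdgeSet (coneEdges A S) ↔ IsForestEdgeSet A ∧
      Set.InjOn (SimpleGraph.fromEdgeSet (A : Set (Sym2 V))).connectedComponentMk
        (S : Set V) := by
  rw [IsForestEdgeSet, fromEdgeSet_coneEdges, SimpleGraph.isAcyclic_coneOver_iff, IsForestEdgeSet]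

end coneEdges

lemma apexGraph_eq_coneOver {V : Type*} (G : SimpleGraph V) :
    apexGraph G = G.coneOver Set.univ := by
  ext (_ | u) (_ | v) <;> simp [apexGraph, G.adj_comm]
  exact fun h => h.ne

/-- Let `G = (V, E)` be a finite simple graph in which every edge has weight the single
variable `w = X ∈ ℤ[w]`, and let `G'` be obtained from `G` by adding an apex joined to
every `v ∈ V` by an edge of weight `−1` (so the weight function `W` of `G'` assigns `X` to
the edges of `G` and `−1` to the apex edges).  Then the multivariate forest polynomial of
`G'` satisfies `F(G') = Σ_{A ∈ 𝔽(G)} w^{|A|} · ∏_{T ∈ c(A)} (1 − |T|)`. -/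
theorem forest_polynomial_apex_specialized {V : Type*} [Fintype V]
    (G : SimpleGraph V) (W : Sym2 (Option V) → Polynomial ℤ)
    (hW1 : ∀ u v : V, G.Adj u v → W s(some u, some v) = Polynomial.X)
    (hW2 : ∀ v : V, W s(none, some v) = -1) :
    ∑ A' ∈ (apexGraph G).edgeFinset.powerset.filter IsForestEdgeSet, ∏ e ∈ A', W e
    = ∑ A ∈ G.edgeFinset.powerset.filter IsForestEdgeSet,
        Polynomial.X ^ A.card *
          ∏ T ∈ componentSets (SimpleGraph.fromEdgeSet (A : Set (Sym2 V))),
            (1 - (T.card : Polynomial ℤ)) := by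
  have hmem (A' : Finset (Sym2 (Option V))) : A' ⊆ (apexGraph G).edgeFinset ↔
      ∀ x y, s(x, y) ∈ A' → (G.coneOver Set.univ).Adj x y := by
    simp [Finset.subset_iff, Sym2.forall, apexGraph_eq_coneOver]
  have hexpand (A : Finset (Sym2 V)) :
      ∏ T ∈ componentSets (SimpleGraph.fromEdgeSet (A : Set (Sym2 V))),
        (1 - (T.card : Polynomial ℤ)) =
      ∑ S ∈ (Finset.univ : Finset (Finset V)).filter (fun S : Finset V => Set.InjOn
        (SimpleGraph.fromEdgeSet (A : Set (Sym2 V))).connectedComponentMk (S : Set V)),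
        (-1) ^ S.card := by
    rw [prod_componentSets, Finset.sum_neg_one_pow_card_injOn]
    congr!
  have hinv (A' : Finset (Sym2 (Option V)))
      (hA' : A' ∈ (apexGraph G).edgeFinset.powerset.filter IsForestEdgeSet) :
      coneEdges (Finset.univ.filter fun e => e.map some ∈ A')
        (Finset.univ.filter fun v => s(none, some v) ∈ A') = A' := by
    have hloop : s(none, none) ∉ A' := fun h =>
      (hmem A').1 (Finset.mem_powerset.1 (Finset.mem_filter.1 hA').1) none none h
    ext e
    induction e using Sym2.ind with | _ x y
    rcases x with _ | u <;> rcases y with _ | v <;>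
      simp [hloop, Sym2.eq_swap (a := some _) (b := none)]
  simp_rw [hexpand, Finset.mul_sum]
  rw [Finset.sum_sigma']
  symm
  refine Finset.sum_bij' (fun p _ => coneEdges p.1 p.2)
    (fun A' _ => ⟨Finset.univ.filter fun e => e.map some ∈ A',
      Finset.univ.filter fun v => s(none, some v) ∈ A'⟩) ?_ ?_ ?_ ?_ ?_
  · rintro ⟨A, S⟩ h
    simp only [Finset.mem_sigma, Finset.mem_filter, Finset.mem_powerset, Finset.mem_univ,
      true_and] at h ⊢
    refine ⟨(hmem _).2 ?_, isForestEdgeSet_coneEdges.2 ⟨h.1.2, h.2⟩⟩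
    rintro (_ | u) (_ | v) he
    · simp at he
    · trivial
    · trivial
    · simpa using h.1.1 (some_some_mem_coneEdges.1 he)
  · intro A' hA'
    have hcone := hinv A' hA'
    simp only [Finset.mem_sigma, Finset.mem_filter, Finset.mem_powerset, Finset.mem_univ,
      true_and] at hA' ⊢
    rw [and_assoc, ← isForestEdgeSet_coneEdges, hcone]
    refine ⟨fun e he => ?_, hA'.2⟩
    induction e using Sym2.ind with | _ u v
    simpa using (hmem A').1 hA'.1 (some u) (some v) (by simpa using he)
  · rintro ⟨A, S⟩ h
    have hA : (Finset.univ.filter fun e : Sym2 V => e.map some ∈ coneEdges A S) = A := by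
      ext e
      induction e using Sym2.ind
      simp
    simp [hA]
  · exact hinv
  · rintro ⟨A, S⟩ h
    simp only [Finset.mem_sigma, Finset.mem_filter, Finset.mem_powerset] at h
    have hA : ∏ e ∈ A, W (e.map some) = ∏ e ∈ A, Polynomial.X := by
      refine Finset.prod_congr rfl fun e he => ?_
      induction e using Sym2.ind with | _ u v
      exact hW1 u v (by simpa using h.1.1 he)
    simp [prod_coneEdges, hA, hW2]
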